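/- Let Λ be a full-rank lattice in ℂ, σ > 2 real, z ∈ ℂ and y > 0. Then Σ_{λ∈Λ} (|λ + z|² + y²)^{−σ} ≤ C·(y^{−2σ} + y^{2−2σ}) for a constant C depending only on Λ and σ, uniformly in z. -/

import Mathlib

open Real

theorem sum_range_one_div_sq_add_sq_le {t : ℝ} (ht : 0 < t) (n : ℕ) :
    ∑ k ∈ Finset.range n, 1 / ((k : ℝ) ^ 2 + t ^ 2) ≤ 1 / t ^ 2 + 2 / t := by
  have telescope : ∀ n : ℕ, ∑ k ∈ Finset.range (n + 1), 1 / ((k : ℝ) ^ 2 + t ^ 2) ≤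
      1 / t ^ 2 + 2 / t - 2 / (n + t) := by
    intro n
    induction n with
    | zero => simp
    | succ n ih =>
      rw [Finset.sum_range_succ]
      have hn : (0 : ℝ) ≤ n := n.cast_nonneg
      have key : 1 / (((n + 1 : ℕ) : ℝ) ^ 2 + t ^ 2) ≤
          2 / (n + t) - 2 / (((n + 1 : ℕ) : ℝ) + t) := by
        push_cast
        rw [div_sub_div _ _ (by positivity) (by positivity),
          div_le_div_iff₀ (by positivity) (by positivity)]
        nlinarith [sq_nonneg ((n : ℝ) + 1 - t)]
      linarith
  cases n with
  | zero => simp only [Finset.range_zero, Finset.sum_empty]; positivity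
  | succ n =>
    have : 0 ≤ 2 / ((n : ℝ) + t) := by positivity
    linarith [telescope n]

theorem summable_one_div_sq_add_sq {t : ℝ} (ht : 0 < t) :
    Summable fun k : ℕ => 1 / ((k : ℝ) ^ 2 + t ^ 2) :=
  summable_of_sum_range_le (fun _ => by positivity) (sum_range_one_div_sq_add_sq_le ht)

theorem tsum_one_div_sq_add_sq_le {t : ℝ} (ht : 0 < t) :
    ∑' k : ℕ, 1 / ((k : ℝ) ^ 2 + t ^ 2) ≤ 1 / t ^ 2 + 2 / t :=
  Real.tsum_le_of_sum_range_le (fun _ => by positivity) (sum_range_one_div_sq_add_sq_le ht)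

theorem summable_int_and_tsum_one_div_add_sq_add_sq_le (a : ℝ) {t : ℝ} (ht : 0 < t) :
    Summable (fun m : ℤ => 1 / ((m + a) ^ 2 + t ^ 2)) ∧
      ∑' m : ℤ, 1 / ((m + a) ^ 2 + t ^ 2) ≤ 2 * (1 / t ^ 2 + 2 / t) := by
  wlog ha : 0 ≤ a ∧ a ≤ 1 generalizing a
  · have h := this (Int.fract a) ⟨Int.fract_nonneg a, (Int.fract_lt_one a).le⟩
    have hcomp : (fun m : ℤ => 1 / ((m + a) ^ 2 + t ^ 2)) =
        (fun m : ℤ => 1 / ((m + Int.fract a) ^ 2 + t ^ 2)) ∘ Equiv.addRight ⌊a⌋ := by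
      ext m
      have : (m : ℝ) + a = ((m + ⌊a⌋ : ℤ) : ℝ) + Int.fract a := by
        push_cast
        linarith [Int.floor_add_fract a]
      simp only [Function.comp_apply, Equiv.coe_addRight, this]
    rw [hcomp]
    refine ⟨(Equiv.summable_iff _).2 h.1, ?_⟩
    exact ((Equiv.addRight ⌊a⌋).tsum_eq
      (fun m : ℤ => 1 / ((m + Int.fract a) ^ 2 + t ^ 2))).trans_le h.2
  obtain ⟨ha0, ha1⟩ := ha
  have hs := summable_one_div_sq_add_sq ht
  have h1 (n : ℕ) : 1 / ((((n : ℤ) : ℝ) + a) ^ 2 + t ^ 2) ≤ 1 / ((n : ℝ) ^ 2 + t ^ 2) := by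
    have hn : (0 : ℝ) ≤ n := n.cast_nonneg
    push_cast
    gcongr
    linarith
  have h2 (n : ℕ) : 1 / (((-((n : ℤ) + 1) : ℤ) + a) ^ 2 + t ^ 2) ≤
      1 / ((n : ℝ) ^ 2 + t ^ 2) := by
    have hn : (0 : ℝ) ≤ n := n.cast_nonneg
    push_cast
    apply one_div_le_one_div_of_le (by positivity)
    nlinarith
  have s1 := Summable.of_nonneg_of_le (fun n => by positivity) h1 hs
  have s2 := Summable.of_nonneg_of_le (fun n => by positivity) h2 hs
  refine ⟨Summable.of_nat_of_neg_add_one s1 s2, ?_⟩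
  rw [tsum_of_nat_of_neg_add_one (f := fun m : ℤ => 1 / ((m + a) ^ 2 + t ^ 2)) s1 s2]
  linarith [s1.tsum_le_tsum h1 hs, s2.tsum_le_tsum h2 hs, tsum_one_div_sq_add_sq_le ht]

theorem rpow_neg_le_mul_one_div_mul_one_div {σ M N y A B : ℝ} (hσ : 2 ≤ σ) (hM : 0 < M)
    (hy : 0 < y) (hN : y ^ 2 ≤ N) (hA : A ^ 2 + y ^ 2 ≤ M * N) (hB : B ^ 2 + y ^ 2 ≤ M * N) :
    N ^ (-σ) ≤ M ^ 2 * y ^ (4 - 2 * σ) *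
      (1 / (A ^ 2 + y ^ 2) * (1 / (B ^ 2 + y ^ 2))) := by
  have hN0 : 0 < N := lt_of_lt_of_le (by positivity) hN
  have hsplit : N ^ (-σ) = N ^ (2 - σ) * (1 / N ^ 2) := by
    rw [show -σ = (2 - σ) - (2 : ℕ) by push_cast; ring, rpow_sub_natCast hN0.ne']
    ring
  have hfst : N ^ (2 - σ) ≤ y ^ (4 - 2 * σ) := by
    calc N ^ (2 - σ) ≤ (y ^ 2) ^ (2 - σ) :=
          rpow_le_rpow_of_nonpos (by positivity) hN (by linarith)
      _ = y ^ (4 - 2 * σ) := by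
          rw [← rpow_natCast, ← rpow_mul hy.le]
          congr 1
          push_cast
          ring
  have hsnd : 1 / N ^ 2 ≤ M ^ 2 * (1 / (A ^ 2 + y ^ 2) * (1 / (B ^ 2 + y ^ 2))) := by
    rw [one_div_mul_one_div, mul_one_div,
      div_le_div_iff₀ (by positivity) (by positivity), one_mul, ← mul_pow, sq (M * N)]
    gcongr
  calc N ^ (-σ) = N ^ (2 - σ) * (1 / N ^ 2) := hsplit
    _ ≤ y ^ (4 - 2 * σ) * (M ^ 2 * (1 / (A ^ 2 + y ^ 2) * (1 / (B ^ 2 + y ^ 2)))) := by gcongr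
    _ = _ := by ring

theorem exists_equiv_int_prod_coord_sq_le (Λ : Submodule ℤ ℂ) [DiscreteTopology Λ]
    [IsZLattice ℝ Λ] :
    ∃ (e : Λ ≃ ℤ × ℤ) (M : ℝ), 1 ≤ M ∧ ∀ z : ℂ, ∃ a b : ℝ, ∀ l : Λ,
      ((e l).1 + a) ^ 2 ≤ M * ‖(l : ℂ) + z‖ ^ 2 ∧ ((e l).2 + b) ^ 2 ≤ M * ‖(l : ℂ) + z‖ ^ 2 := by
  have : Module.Free ℤ Λ := ZLattice.module_free ℝ Λ
  have : Module.Finite ℤ Λ := ZLattice.module_finite ℝ Λ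
  let b : Module.Basis (Fin 2) ℤ Λ := Module.finBasisOfFinrankEq ℤ Λ
    ((ZLattice.rank ℝ Λ).trans Complex.finrank_real_complex)
  let B := b.ofZLatticeBasis ℝ Λ
  let L : ℂ →L[ℝ] (Fin 2 → ℝ) := B.equivFunL
  refine ⟨b.equivFun.toEquiv.trans (finTwoArrowEquiv ℤ), (‖L‖ + 1) ^ 2,
    by nlinarith [norm_nonneg L], fun z => ⟨L z 0, L z 1, fun l => ?_⟩⟩
  have key (i : Fin 2) : ((b.repr l i : ℝ) + L z i) ^ 2 ≤ (‖L‖ + 1) ^ 2 * ‖(l : ℂ) + z‖ ^ 2 := by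
    have hcoord : (b.repr l i : ℝ) + L z i = L (l + z) i := by
      rw [map_add, Pi.add_apply]
      congr 1
      exact (b.ofZLatticeBasis_repr_apply ℝ Λ l i).symm
    rw [hcoord, ← mul_pow, ← sq_abs]
    gcongr
    calc |L (l + z) i| ≤ ‖L (l + z)‖ := norm_le_pi_norm (L (l + z)) i
      _ ≤ ‖L‖ * ‖(l : ℂ) + z‖ := L.le_opNorm _
      _ ≤ (‖L‖ + 1) * ‖(l : ℂ) + z‖ := by gcongr; linarith
  exact ⟨key 0, key 1⟩

/-- **Hyperbolic lattice-sum estimate.**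
For a full-rank lattice `Λ ⊂ ℂ` and `σ > 2`,
`Σ_{λ∈Λ} (|λ+z|²+y²)^{-σ} ≤ C·(y^{-2σ}+y^{2-2σ})` uniformly in `z ∈ ℂ` and `y > 0`,
with `C` depending only on `Λ` and `σ`. -/
theorem hyperbolic_lattice_sum_estimate
    (Λ : Submodule ℤ ℂ) [DiscreteTopology Λ] [IsZLattice ℝ Λ]
    (σ : ℝ) (hσ : 2 < σ) :
    ∃ C : ℝ, 0 < C ∧ ∀ (z : ℂ) (y : ℝ), 0 < y →
      Summable (fun l : Λ => (‖(l : ℂ) + z‖ ^ 2 + y ^ 2) ^ (-σ)) ∧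
      ∑' l : Λ, (‖(l : ℂ) + z‖ ^ 2 + y ^ 2) ^ (-σ)
        ≤ C * (y ^ (-(2 * σ)) + y ^ (2 - 2 * σ)) := by
  obtain ⟨e, M, hM, hcoord⟩ := exists_equiv_int_prod_coord_sq_le Λ
  refine ⟨32 * M ^ 2, by positivity, fun z y hy => ?_⟩
  obtain ⟨a, b, hab⟩ := hcoord z
  obtain ⟨sa, ta⟩ := summable_int_and_tsum_one_div_add_sq_add_sq_le a hy
  obtain ⟨sb, tb⟩ := summable_int_and_tsum_one_div_add_sq_add_sq_le b hy
  set f : ℤ → ℝ := fun m => 1 / ((m + a) ^ 2 + y ^ 2) with hf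
  set g : ℤ → ℝ := fun m => 1 / ((m + b) ^ 2 + y ^ 2) with hg
  have hf0 : 0 ≤ f := fun m => by simp only [hf, Pi.zero_apply]; positivity
  have hg0 : 0 ≤ g := fun m => by simp only [hg, Pi.zero_apply]; positivity
  have sfg : Summable fun p : ℤ × ℤ => f p.1 * g p.2 := sa.mul_of_nonneg sb hf0 hg0
  have hle (l : Λ) : (‖(l : ℂ) + z‖ ^ 2 + y ^ 2) ^ (-σ) ≤
      M ^ 2 * y ^ (4 - 2 * σ) * (f (e l).1 * g (e l).2) := by
    have hyM : y ^ 2 ≤ M * y ^ 2 := le_mul_of_one_le_left (sq_nonneg y) hM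
    exact rpow_neg_le_mul_one_div_mul_one_div hσ.le (by linarith) hy
      (by linarith [sq_nonneg ‖(l : ℂ) + z‖]) (by linarith [(hab l).1]) (by linarith [(hab l).2])
  have smaj : Summable fun l : Λ => M ^ 2 * y ^ (4 - 2 * σ) * (f (e l).1 * g (e l).2) :=
    ((e.summable_iff (f := fun p : ℤ × ℤ => f p.1 * g p.2)).2 sfg).mul_left _
  have hsum := Summable.of_nonneg_of_le (fun l => by positivity) hle smaj
  refine ⟨hsum, ?_⟩
  have hpow4 : y ^ (4 - 2 * σ) * (1 / y ^ 4) = y ^ (-(2 * σ)) := by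
    rw [show -(2 * σ) = (4 - 2 * σ) - (4 : ℕ) by push_cast; ring, rpow_sub_natCast hy.ne']
    ring
  have hpow2 : y ^ (4 - 2 * σ) * (1 / y ^ 2) = y ^ (2 - 2 * σ) := by
    rw [show 2 - 2 * σ = (4 - 2 * σ) - (2 : ℕ) by push_cast; ring, rpow_sub_natCast hy.ne']
    ring
  calc ∑' l : Λ, (‖(l : ℂ) + z‖ ^ 2 + y ^ 2) ^ (-σ)
      ≤ ∑' l : Λ, M ^ 2 * y ^ (4 - 2 * σ) * (f (e l).1 * g (e l).2) :=
        hsum.tsum_le_tsum hle smaj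
    _ = M ^ 2 * y ^ (4 - 2 * σ) * ((∑' m, f m) * ∑' m, g m) := by
        rw [tsum_mul_left, e.tsum_eq (fun p : ℤ × ℤ => f p.1 * g p.2),
          sa.tsum_mul_tsum sb sfg]
    _ ≤ M ^ 2 * y ^ (4 - 2 * σ) *
          ((2 * (1 / y ^ 2 + 2 / y)) * (2 * (1 / y ^ 2 + 2 / y))) := by
        gcongr
    _ ≤ M ^ 2 * y ^ (4 - 2 * σ) * (32 * (1 / y ^ 4 + 1 / y ^ 2)) := by
        refine mul_le_mul_of_nonneg_left ?_ (by positivity)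
        have h4 : 1 / y ^ 4 = (1 / y) ^ 4 := by rw [one_div_pow]
        have h2 : 1 / y ^ 2 = (1 / y) ^ 2 := by rw [one_div_pow]
        rw [h4, h2, show 2 / y = 2 * (1 / y) by ring]
        nlinarith [sq_nonneg ((1 / y) ^ 2 - 1 / y), sq_nonneg ((1 / y) ^ 2), sq_nonneg (1 / y)]
    _ = 32 * M ^ 2 * (y ^ (-(2 * σ)) + y ^ (2 - 2 * σ)) := by
        rw [← hpow4, ← hpow2]
        ring
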